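/- Let Φ₀, Φ₁, Ψ₀, Ψ₁ : [0,∞) → [0,∞) be strictly increasing bijections that are differentiable on (0,∞) with positive derivative on (0,∞), and suppose that for i = 0, 1 there exists a real number cᵢ such that for all t > 0, t·Ψᵢ′(t)/Ψᵢ(t) ≥ cᵢ and t·Φᵢ′(t)/Φᵢ(t) ≤ cᵢ (that is, a_{Ψᵢ} ≥ b_{Φᵢ} for the Matuszewska–Orlicz indices). For θ ∈ [0,1] define Φ_θ⁻¹(t) = Φ₀⁻¹(t)^{1−θ} · Φ₁⁻¹(t)^θ and Ψ_θ⁻¹(t) = Ψ₀⁻¹(t)^{1−θ} · Ψ₁⁻¹(t)^θ. Then the ratio t ↦ Φ_θ⁻¹(t)/Ψ_θ⁻¹(t) is nondecreasing on (0,∞). -/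

import Mathlib

open Set in
/-- A lower bound `c ≤ t * f' t / f t` makes `log ∘ f - c * log` nondecreasing. -/
theorem monotoneOn_log_sub_mul_log {f f' : ℝ → ℝ} {c : ℝ}
    (hd : ∀ t > (0 : ℝ), HasDerivAt f (f' t) t) (hpos : ∀ t > (0 : ℝ), 0 < f t)
    (hc : ∀ t > (0 : ℝ), c ≤ t * f' t / f t) :
    MonotoneOn (fun t => Real.log (f t) - c * Real.log t) (Ioi 0) := by
  have hderiv : ∀ t > (0 : ℝ), HasDerivAt (fun t => Real.log (f t) - c * Real.log t)
      (f' t / f t - c * t⁻¹) t := fun t ht =>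
    ((hd t ht).log (hpos t ht).ne').sub ((Real.hasDerivAt_log ht.ne').const_mul c)
  refine monotoneOn_of_hasDerivWithinAt_nonneg (convex_Ioi 0)
    (fun t ht => (hderiv t ht).continuousAt.continuousWithinAt)
    (fun t ht => (hderiv t (interior_subset ht)).hasDerivWithinAt) fun t ht => ?_
  have ht : 0 < t := interior_subset ht
  have h := hc t ht
  rw [mul_div_assoc, ← div_le_iff₀' ht, div_eq_mul_inv c] at h
  linarith

open Set in
/-- An upper bound `t * f' t / f t ≤ c` makes `log ∘ f - c * log` nonincreasing. -/
theorem antitoneOn_log_sub_mul_log {f f' : ℝ → ℝ} {c : ℝ}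
    (hd : ∀ t > (0 : ℝ), HasDerivAt f (f' t) t) (hpos : ∀ t > (0 : ℝ), 0 < f t)
    (hc : ∀ t > (0 : ℝ), t * f' t / f t ≤ c) :
    AntitoneOn (fun t => Real.log (f t) - c * Real.log t) (Ioi 0) := by
  have hderiv : ∀ t > (0 : ℝ), HasDerivAt (fun t => Real.log (f t) - c * Real.log t)
      (f' t / f t - c * t⁻¹) t := fun t ht =>
    ((hd t ht).log (hpos t ht).ne').sub ((Real.hasDerivAt_log ht.ne').const_mul c)
  refine antitoneOn_of_hasDerivWithinAt_nonpos (convex_Ioi 0)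
    (fun t ht => (hderiv t ht).continuousAt.continuousWithinAt)
    (fun t ht => (hderiv t (interior_subset ht)).hasDerivWithinAt) fun t ht => ?_
  have ht : 0 < t := interior_subset ht
  have h := hc t ht
  rw [mul_div_assoc, ← le_div_iff₀' ht, div_eq_mul_inv c] at h
  linarith

open Set in
theorem inv_pos_of_bijOn_Ici {f g : ℝ → ℝ} (hmono : StrictMonoOn f (Ici 0))
    (hbij : BijOn f (Ici 0) (Ici 0)) (hinv : InvOn g f (Ici 0) (Ici 0)) {t : ℝ} (ht : 0 < t) :
    0 < g t := by
  obtain ⟨x, hx, rfl⟩ := hbij.surjOn (mem_Ici.2 ht.le)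
  obtain ⟨z, hz, hfz⟩ := hbij.surjOn (mem_Ici.2 le_rfl)
  rw [hinv.1 hx]
  exact (mem_Ici.1 hz).trans_lt ((hmono.lt_iff_lt hz hx).1 (hfz ▸ ht))

open Set in
theorem inv_le_inv_of_bijOn_Ici {f g : ℝ → ℝ} (hmono : StrictMonoOn f (Ici 0))
    (hbij : BijOn f (Ici 0) (Ici 0)) (hinv : InvOn g f (Ici 0) (Ici 0)) {s t : ℝ}
    (hs : 0 < s) (hst : s ≤ t) : g s ≤ g t := by
  have ht := hs.trans_le hst
  refine (hmono.le_iff_le (inv_pos_of_bijOn_Ici hmono hbij hinv hs).le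
    (inv_pos_of_bijOn_Ici hmono hbij hinv ht).le).1 ?_
  rwa [hinv.2 (mem_Ici.2 hs.le), hinv.2 (mem_Ici.2 ht.le)]

open Set in
/-- If the lower index of `Ψ` dominates the upper index of `Φ`, the ratio of the inverses
`Φ⁻¹ / Ψ⁻¹` is nondecreasing on `(0, ∞)`. -/
theorem monotoneOn_inv_div_inv {Φ Ψ Φinv Ψinv Φ' Ψ' : ℝ → ℝ} {c : ℝ}
    (hΦmono : StrictMonoOn Φ (Ici 0)) (hΨmono : StrictMonoOn Ψ (Ici 0))
    (hΦbij : BijOn Φ (Ici 0) (Ici 0)) (hΨbij : BijOn Ψ (Ici 0) (Ici 0))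
    (hΦinv : InvOn Φinv Φ (Ici 0) (Ici 0)) (hΨinv : InvOn Ψinv Ψ (Ici 0) (Ici 0))
    (hΦd : ∀ t > (0 : ℝ), HasDerivAt Φ (Φ' t) t) (hΨd : ∀ t > (0 : ℝ), HasDerivAt Ψ (Ψ' t) t)
    (hΦpos : ∀ t > (0 : ℝ), 0 < Φ t) (hΨpos : ∀ t > (0 : ℝ), 0 < Ψ t) (hc : 0 < c)
    (hΨc : ∀ t > (0 : ℝ), c ≤ t * Ψ' t / Ψ t) (hΦc : ∀ t > (0 : ℝ), t * Φ' t / Φ t ≤ c) :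
    MonotoneOn (fun t => Φinv t / Ψinv t) (Ioi 0) := by
  intro s hs t ht hst
  have hs0 : 0 < s := hs
  have ht0 : 0 < t := ht
  have hx := inv_pos_of_bijOn_Ici hΦmono hΦbij hΦinv hs0
  have hy := inv_pos_of_bijOn_Ici hΦmono hΦbij hΦinv ht0
  have hu := inv_pos_of_bijOn_Ici hΨmono hΨbij hΨinv hs0
  have hv := inv_pos_of_bijOn_Ici hΨmono hΨbij hΨinv ht0
  have h₁ := antitoneOn_log_sub_mul_log hΦd hΦpos hΦc hx hy
    (inv_le_inv_of_bijOn_Ici hΦmono hΦbij hΦinv hs0 hst)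
  have h₂ := monotoneOn_log_sub_mul_log hΨd hΨpos hΨc hu hv
    (inv_le_inv_of_bijOn_Ici hΨmono hΨbij hΨinv hs0 hst)
  simp only [hΦinv.2 (mem_Ici.2 hs0.le), hΦinv.2 (mem_Ici.2 ht0.le)] at h₁
  simp only [hΨinv.2 (mem_Ici.2 hs0.le), hΨinv.2 (mem_Ici.2 ht0.le)] at h₂
  refine (Real.log_le_log_iff (div_pos hx hu) (div_pos hy hv)).1 ?_
  rw [Real.log_div hx.ne' hu.ne', Real.log_div hy.ne' hv.ne']
  refine le_of_mul_le_mul_left ?_ hc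
  linarith

/-- for strictly increasing differentiable bijections `Φ₀, Φ₁, Ψ₀, Ψ₁` of
`[0,∞)` with positive derivatives satisfying `a_{Ψᵢ} ≥ b_{Φᵢ}` (witnessed by reals `cᵢ`),
the ratio of the log-convex interpolations of the inverses,
`t ↦ Φ_θ⁻¹(t)/Ψ_θ⁻¹(t) = (Φ₀⁻¹ t)^(1-θ)(Φ₁⁻¹ t)^θ / ((Ψ₀⁻¹ t)^(1-θ)(Ψ₁⁻¹ t)^θ)`,
is nondecreasing on `(0,∞)`. -/
theorem stmt13 (Φ₀ Φ₁ Ψ₀ Ψ₁ Φ₀inv Φ₁inv Ψ₀inv Ψ₁inv Φ₀' Φ₁' Ψ₀' Ψ₁' : ℝ → ℝ)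
    (hΦ₀mono : StrictMonoOn Φ₀ (Set.Ici 0)) (hΦ₁mono : StrictMonoOn Φ₁ (Set.Ici 0))
    (hΨ₀mono : StrictMonoOn Ψ₀ (Set.Ici 0)) (hΨ₁mono : StrictMonoOn Ψ₁ (Set.Ici 0))
    (hΦ₀bij : Set.BijOn Φ₀ (Set.Ici 0) (Set.Ici 0))
    (hΦ₁bij : Set.BijOn Φ₁ (Set.Ici 0) (Set.Ici 0))
    (hΨ₀bij : Set.BijOn Ψ₀ (Set.Ici 0) (Set.Ici 0))
    (hΨ₁bij : Set.BijOn Ψ₁ (Set.Ici 0) (Set.Ici 0))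
    (hΦ₀inv : Set.InvOn Φ₀inv Φ₀ (Set.Ici 0) (Set.Ici 0))
    (hΦ₁inv : Set.InvOn Φ₁inv Φ₁ (Set.Ici 0) (Set.Ici 0))
    (hΨ₀inv : Set.InvOn Ψ₀inv Ψ₀ (Set.Ici 0) (Set.Ici 0))
    (hΨ₁inv : Set.InvOn Ψ₁inv Ψ₁ (Set.Ici 0) (Set.Ici 0))
    (hΦ₀diff : ∀ t > (0:ℝ), HasDerivAt Φ₀ (Φ₀' t) t)
    (hΦ₁diff : ∀ t > (0:ℝ), HasDerivAt Φ₁ (Φ₁' t) t)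
    (hΨ₀diff : ∀ t > (0:ℝ), HasDerivAt Ψ₀ (Ψ₀' t) t)
    (hΨ₁diff : ∀ t > (0:ℝ), HasDerivAt Ψ₁ (Ψ₁' t) t)
    (hΦ₀'pos : ∀ t > (0:ℝ), 0 < Φ₀' t) (hΦ₁'pos : ∀ t > (0:ℝ), 0 < Φ₁' t)
    (hΨ₀'pos : ∀ t > (0:ℝ), 0 < Ψ₀' t) (hΨ₁'pos : ∀ t > (0:ℝ), 0 < Ψ₁' t)
    (hΦ₀pos : ∀ t > (0:ℝ), 0 < Φ₀ t) (hΦ₁pos : ∀ t > (0:ℝ), 0 < Φ₁ t)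
    (hΨ₀pos : ∀ t > (0:ℝ), 0 < Ψ₀ t) (hΨ₁pos : ∀ t > (0:ℝ), 0 < Ψ₁ t)
    (c₀ c₁ : ℝ)
    (hΨ₀idx : ∀ t > (0:ℝ), c₀ ≤ t * Ψ₀' t / Ψ₀ t)
    (hΦ₀idx : ∀ t > (0:ℝ), t * Φ₀' t / Φ₀ t ≤ c₀)
    (hΨ₁idx : ∀ t > (0:ℝ), c₁ ≤ t * Ψ₁' t / Ψ₁ t)
    (hΦ₁idx : ∀ t > (0:ℝ), t * Φ₁' t / Φ₁ t ≤ c₁)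
    (θ : ℝ) (hθ : θ ∈ Set.Icc (0:ℝ) 1) :
    MonotoneOn
      (fun t => Φ₀inv t ^ (1 - θ) * Φ₁inv t ^ θ / (Ψ₀inv t ^ (1 - θ) * Ψ₁inv t ^ θ))
      (Set.Ioi 0) := by
  have hc₀ : 0 < c₀ := (div_pos (mul_pos one_pos (hΦ₀'pos 1 one_pos))
    (hΦ₀pos 1 one_pos)).trans_le (hΦ₀idx 1 one_pos)
  have hc₁ : 0 < c₁ := (div_pos (mul_pos one_pos (hΦ₁'pos 1 one_pos))
    (hΦ₁pos 1 one_pos)).trans_le (hΦ₁idx 1 one_pos)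
  have hmono₀ := monotoneOn_inv_div_inv hΦ₀mono hΨ₀mono hΦ₀bij hΨ₀bij hΦ₀inv hΨ₀inv
    hΦ₀diff hΨ₀diff hΦ₀pos hΨ₀pos hc₀ hΨ₀idx hΦ₀idx
  have hmono₁ := monotoneOn_inv_div_inv hΦ₁mono hΨ₁mono hΦ₁bij hΨ₁bij hΦ₁inv hΨ₁inv
    hΦ₁diff hΨ₁diff hΦ₁pos hΨ₁pos hc₁ hΨ₁idx hΦ₁idx
  have hpos₀ : ∀ t > (0 : ℝ), 0 < Φ₀inv t ∧ 0 < Ψ₀inv t := fun t ht =>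
    ⟨inv_pos_of_bijOn_Ici hΦ₀mono hΦ₀bij hΦ₀inv ht, inv_pos_of_bijOn_Ici hΨ₀mono hΨ₀bij hΨ₀inv ht⟩
  have hpos₁ : ∀ t > (0 : ℝ), 0 < Φ₁inv t ∧ 0 < Ψ₁inv t := fun t ht =>
    ⟨inv_pos_of_bijOn_Ici hΦ₁mono hΦ₁bij hΦ₁inv ht, inv_pos_of_bijOn_Ici hΨ₁mono hΨ₁bij hΨ₁inv ht⟩
  have hsplit : ∀ t > (0 : ℝ),
      Φ₀inv t ^ (1 - θ) * Φ₁inv t ^ θ / (Ψ₀inv t ^ (1 - θ) * Ψ₁inv t ^ θ) =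
        (Φ₀inv t / Ψ₀inv t) ^ (1 - θ) * (Φ₁inv t / Ψ₁inv t) ^ θ := fun t ht => by
    rw [Real.div_rpow (hpos₀ t ht).1.le (hpos₀ t ht).2.le,
      Real.div_rpow (hpos₁ t ht).1.le (hpos₁ t ht).2.le, div_mul_div_comm]
  intro s hs t ht hst
  simp only [hsplit s hs, hsplit t ht]
  have hr₀ := div_pos (hpos₀ s hs).1 (hpos₀ s hs).2
  have hr₁ := div_pos (hpos₁ s hs).1 (hpos₁ s hs).2
  have h₀ := hmono₀ hs ht hst
  have h₁ := hmono₁ hs ht hst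
  exact mul_le_mul (Real.rpow_le_rpow hr₀.le h₀ (sub_nonneg.2 hθ.2))
    (Real.rpow_le_rpow hr₁.le h₁ hθ.1) (Real.rpow_nonneg hr₁.le _)
    (Real.rpow_nonneg (hr₀.le.trans h₀) _)
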